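/- Let Y be a ℤ-module, Q : Y → ℤ a quadratic map, and n a positive integer. Let v, w ∈ Y and f, g : Y → ℤ be ℤ-linear maps with f(v) = 2 and g(w) = 2, and suppose Q is invariant under both reflections y ↦ y − f(y) • v and y ↦ y − g(y) • w. Set n_v = n / gcd(n, Q(v)) and n_w = n / gcd(n, Q(w)). Then n_v divides n_w · f(w). (In the paper's notation, with v = φ∨, w = ψ∨, this says the modified Cartan integer ⟨φ̃, ψ̃∨⟩ = (n_ψ / n_φ)⟨φ, ψ∨⟩ is an integer, a key integrality in the construction of the modified root datum Ψ̃.) -/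

import Mathlib

/-- The polar form `B_Q(y₁, y₂) = Q(y₁ + y₂) − Q(y₁) − Q(y₂)` of a map `Q : Y → ℤ`. -/
def polarForm {Y : Type*} [AddCommGroup Y] (Q : Y → ℤ) (y₁ y₂ : Y) : ℤ :=
  Q (y₁ + y₂) - Q y₁ - Q y₂

/-- `Q : Y → ℤ` is a quadratic map: `Q(k • y) = k² Q(y)` and the polar form is
additive (hence, by symmetry, ℤ-bilinear). -/
def IsQuadraticMap {Y : Type*} [AddCommGroup Y] (Q : Y → ℤ) : Prop :=
  (∀ (k : ℤ) (y : Y), Q (k • y) = k ^ 2 * Q y) ∧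
  (∀ y₁ y₂ y₃ : Y, polarForm Q (y₁ + y₂) y₃ = polarForm Q y₁ y₃ + polarForm Q y₂ y₃)

theorem polarForm_comm {Y : Type*} [AddCommGroup Y] (Q : Y → ℤ) (y₁ y₂ : Y) :
    polarForm Q y₁ y₂ = polarForm Q y₂ y₁ := by
  unfold polarForm
  rw [add_comm y₁ y₂]
  ring

theorem IsQuadraticMap.polarForm_zsmul_left {Y : Type*} [AddCommGroup Y] {Q : Y → ℤ}
    (hQ : IsQuadraticMap Q) (k : ℤ) (y z : Y) :
    polarForm Q (k • y) z = k * polarForm Q y z := by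
  simpa using map_zsmul (AddMonoidHom.mk' (fun y => polarForm Q y z) (hQ.2 · · z)) k y

theorem IsQuadraticMap.polarForm_self {Y : Type*} [AddCommGroup Y] {Q : Y → ℤ}
    (hQ : IsQuadraticMap Q) (y : Y) : polarForm Q y y = 2 * Q y := by
  have h := hQ.1 2 y
  rw [two_smul] at h
  unfold polarForm
  rw [h]
  ring

/-- If `Q` is invariant under the reflection attached to `(v, f)`, then
`B_Q(v, y) = f(y) Q(v)`. -/
theorem IsQuadraticMap.polarForm_eq_of_reflection_invariant {Y : Type*} [AddCommGroup Y]
    {Q : Y → ℤ} (hQ : IsQuadraticMap Q) {v : Y} {f : Y →ₗ[ℤ] ℤ} (hfv : f v = 2)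
    (hinv : ∀ y : Y, Q (y - f y • v) = Q y) (y : Y) :
    polarForm Q v y = f y * Q v := by
  have of_ne_zero : ∀ z : Y, f z ≠ 0 → polarForm Q v z = f z * Q v := by
    intro z hz
    have hpolar := hQ.polarForm_zsmul_left (-f z) v z
    have hsmul := hQ.1 (-f z) v
    have hz' := hinv z
    rw [sub_eq_add_neg, ← neg_smul, add_comm] at hz'
    rw [polarForm, hz', hsmul] at hpolar
    apply mul_left_cancel₀ hz
    linarith
  by_cases hy : f y = 0
  · have h := of_ne_zero (y + v) (by simp [hy, hfv])
    rw [polarForm_comm, hQ.2, hQ.polarForm_self, map_add, hfv, hy, polarForm_comm] at h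
    rw [hy]
    linarith
  · exact of_ne_zero y hy

theorem natCast_div_gcd_dvd_iff {n : ℕ} (hn : 0 < n) (q x : ℤ) :
    ((n / Int.gcd (n : ℤ) q : ℕ) : ℤ) ∣ x ↔ (n : ℤ) ∣ x * q := by
  have hd : 0 < Int.gcd (n : ℤ) q := Int.gcd_pos_of_ne_zero_left _ (by omega)
  have hd' : (Int.gcd (n : ℤ) q : ℤ) ≠ 0 := by exact_mod_cast hd.ne'
  have hcop := Int.isCoprime_iff_gcd_eq_one.mpr (Int.gcd_ediv_gcd_ediv_gcd hd)
  have hn' := Int.mul_ediv_cancel' (Int.gcd_dvd_left (n : ℤ) q)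
  have hq' := Int.mul_ediv_cancel' (Int.gcd_dvd_right (n : ℤ) q)
  have h : (n : ℤ) / Int.gcd (n : ℤ) q ∣ x * (q / Int.gcd (n : ℤ) q) ↔
      (n : ℤ) ∣ x * q := by
    rw [← mul_dvd_mul_iff_left hd', hn', mul_left_comm, hq']
  rw [Int.natCast_div, ← h]
  exact ⟨(·.mul_right _), hcop.dvd_of_dvd_mul_right⟩

/-- Integrality of the modified Cartan integers: for coroot–root pairs `(v, f)` and
`(w, g)` whose reflections preserve `Q`, with `n_v = n / gcd(n, Q(v))` and
`n_w = n / gcd(n, Q(w))`, one has `n_v ∣ n_w · f(w)`; i.e.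
`⟨φ̃, ψ̃∨⟩ = (n_ψ / n_φ)⟨φ, ψ∨⟩ ∈ ℤ`. -/
theorem modified_cartan_integrality {Y : Type*} [AddCommGroup Y]
    (Q : Y → ℤ) (hQ : IsQuadraticMap Q) (n : ℕ) (hn : 0 < n)
    (v w : Y) (f g : Y →ₗ[ℤ] ℤ) (hfv : f v = 2) (hgw : g w = 2)
    (hinvf : ∀ y : Y, Q (y - f y • v) = Q y)
    (hinvg : ∀ y : Y, Q (y - g y • w) = Q y) :
    ((n / Int.gcd (n : ℤ) (Q v) : ℕ) : ℤ) ∣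
      ((n / Int.gcd (n : ℤ) (Q w) : ℕ) : ℤ) * f w := by
  rw [natCast_div_gcd_dvd_iff hn]
  have hsymm : f w * Q v = g v * Q w := by
    rw [← hQ.polarForm_eq_of_reflection_invariant hfv hinvf,
      ← hQ.polarForm_eq_of_reflection_invariant hgw hinvg, polarForm_comm]
  rw [mul_assoc, hsymm, mul_left_comm]
  exact ((natCast_div_gcd_dvd_iff hn _ _).mp dvd_rfl).mul_left _
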